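/- Existence of the reduced variables for the Sakaguchi–Kuramoto transformation: Let θ₀ : [0,1] → ℝ be continuous and suppose that for every Θ ∈ [0,2π) the Lebesgue measure of the set {x ∈ [0,1] : θ₀(x) mod 2π = Θ} is strictly less than 1/2. Then there exist γ ∈ [0,1) and Θ ∈ ℝ such that ∫₀¹ sin(θ₀(x) − Θ) / (1 + γ·cos(θ₀(x) − Θ)) dx = 0 and ∫₀¹ (γ + cos(θ₀(x) − Θ)) / (1 + γ·cos(θ₀(x) − Θ)) dx = 0. -/

import Mathlib

open MeasureTheory Set

section HyperbolicBarycenter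

open Filter Topology

variable {α : Type*} {c s : α → ℝ}

lemma half_le_one_add_inner {a b c s : ℝ} (hcs : c ^ 2 + s ^ 2 = 1) :
    (1 - a ^ 2 - b ^ 2) / 2 ≤ 1 + a * c + b * s := by
  have h : |a * c + b * s| ≤ 1 - (1 - a ^ 2 - b ^ 2) / 2 := by
    apply abs_le_of_sq_le_sq
    · have e : (a * c + b * s) ^ 2 + (a * s - b * c) ^ 2
          = (a ^ 2 + b ^ 2) * (c ^ 2 + s ^ 2) := by ring
      rw [hcs] at e
      nlinarith [sq_nonneg (a * s - b * c), sq_nonneg (1 - a ^ 2 - b ^ 2)]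
    · nlinarith [sq_nonneg a, sq_nonneg b]
  linarith [neg_abs_le (a * c + b * s)]

lemma one_add_inner_pos {a b c s : ℝ} (hcs : c ^ 2 + s ^ 2 = 1) (hD : a ^ 2 + b ^ 2 < 1) :
    0 < 1 + a * c + b * s := by
  linarith [half_le_one_add_inner (a := a) (b := b) hcs]

lemma one_add_inner_le_two {a b c s : ℝ} (hcs : c ^ 2 + s ^ 2 = 1) (hD : a ^ 2 + b ^ 2 < 1) :
    1 + a * c + b * s ≤ 2 := by
  nlinarith [sq_nonneg (a - c), sq_nonneg (b - s)]

lemma abs_log_one_add_inner_le {a b c s : ℝ} (hcs : c ^ 2 + s ^ 2 = 1)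
    (hD : a ^ 2 + b ^ 2 < 1) :
    |Real.log (1 + a * c + b * s)| ≤ Real.log 2 - Real.log ((1 - a ^ 2 - b ^ 2) / 2) := by
  have hq : 0 < (1 - a ^ 2 - b ^ 2) / 2 := by linarith
  have h1 := Real.log_le_log hq (half_le_one_add_inner hcs)
  have h2 := Real.log_le_log (one_add_inner_pos hcs hD) (one_add_inner_le_two hcs hD)
  have h3 : Real.log ((1 - a ^ 2 - b ^ 2) / 2) ≤ 0 :=
    Real.log_nonpos hq.le (by nlinarith [sq_nonneg a, sq_nonneg b])
  have h4 : 0 ≤ Real.log 2 := Real.log_nonneg (by norm_num)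
  rw [abs_le]
  constructor <;> linarith

variable [MeasurableSpace α] {μ : Measure α}

lemma integrable_log_one_add_inner [IsFiniteMeasure μ] (hc : Measurable c) (hs : Measurable s)
    (hcs : ∀ x, c x ^ 2 + s x ^ 2 = 1) {a b : ℝ} (hD : a ^ 2 + b ^ 2 < 1) :
    Integrable (fun x => Real.log (1 + a * c x + b * s x)) μ :=
  .of_bound (Measurable.log (by fun_prop)).aestronglyMeasurable _
    (.of_forall fun x => abs_log_one_add_inner_le (hcs x) hD)

lemma integrable_div_one_add_inner [IsFiniteMeasure μ] (hc : Measurable c) (hs : Measurable s)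
    (hcs : ∀ x, c x ^ 2 + s x ^ 2 = 1) {a b : ℝ} (hD : a ^ 2 + b ^ 2 < 1)
    {f : α → ℝ} (hf : Measurable f) (hf1 : ∀ x, |f x| ≤ 1) :
    Integrable (fun x => f x / (1 + a * c x + b * s x)) μ := by
  refine .of_bound (hf.div (by fun_prop)).aestronglyMeasurable
    (1 / ((1 - a ^ 2 - b ^ 2) / 2)) (.of_forall fun x => ?_)
  rw [Real.norm_eq_abs, abs_div, abs_of_pos (one_add_inner_pos (hcs x) hD)]
  exact div_le_div₀ zero_le_one (hf1 x) (by linarith) (half_le_one_add_inner (hcs x))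

/-- The averaged Busemann function, in the Klein model of the hyperbolic plane, of the
distribution of the boundary point `-(c, s)` under `μ`. -/
noncomputable def busemannAverage (μ : Measure α) (c s : α → ℝ) (w : ℝ × ℝ) : ℝ :=
  (∫ x, Real.log (1 + w.1 * c x + w.2 * s x) ∂μ) - 1 / 2 * Real.log (1 - w.1 ^ 2 - w.2 ^ 2)

lemma continuousAt_busemannAverage [IsFiniteMeasure μ] (hc : Measurable c) (hs : Measurable s)
    (hcs : ∀ x, c x ^ 2 + s x ^ 2 = 1) {w : ℝ × ℝ} (hD : w.1 ^ 2 + w.2 ^ 2 < 1) :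
    ContinuousAt (busemannAverage μ c s) w := by
  set q := 1 - w.1 ^ 2 - w.2 ^ 2 with hq
  have hq0 : 0 < q := by linarith
  have hnear : ∀ᶠ v : ℝ × ℝ in 𝓝 w, q / 2 < 1 - v.1 ^ 2 - v.2 ^ 2 := by
    have : Continuous fun v : ℝ × ℝ => 1 - v.1 ^ 2 - v.2 ^ 2 := by fun_prop
    exact this.continuousAt.eventually (lt_mem_nhds (by linarith))
  refine ContinuousAt.sub ?_ (continuousAt_const.mul (ContinuousAt.log (by fun_prop) hq0.ne'))
  refine continuousAt_of_dominated (bound := fun _ => Real.log 2 - Real.log (q / 2 / 2))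
    (.of_forall fun v => (Measurable.log (by fun_prop)).aestronglyMeasurable) ?_
    (integrable_const _) (.of_forall fun x => ?_)
  · filter_upwards [hnear] with v hv
    refine .of_forall fun x => (abs_log_one_add_inner_le (hcs x) (by linarith)).trans ?_
    gcongr
  · exact ContinuousAt.log (by fun_prop) (one_add_inner_pos (hcs x) hD).ne'

lemma exists_measureReal_sublevel_lt [IsFiniteMeasure μ] {f : α → ℝ} (hf : Measurable f)
    (hf0 : ∀ x, 0 ≤ f x) {m : ℝ} (h : μ.real {x | f x = 0} < m) :
    ∃ δ, 0 < δ ∧ δ ≤ 1 ∧ μ.real {x | f x ≤ 2 * δ} < m := by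
  have hlim : Tendsto (fun n : ℕ => μ {x | f x ≤ 1 / ((n : ℝ) + 1)}) atTop
      (𝓝 (μ (⋂ n : ℕ, {x | f x ≤ 1 / ((n : ℝ) + 1)}))) := by
    refine tendsto_measure_iInter_atTop
      (fun n => (measurableSet_le hf measurable_const).nullMeasurableSet) ?_
      ⟨0, measure_ne_top _ _⟩
    intro i j hij x hx
    exact le_trans (show f x ≤ _ from hx) (Nat.one_div_le_one_div hij)
  have hset : (⋂ n : ℕ, {x | f x ≤ 1 / ((n : ℝ) + 1)}) = {x | f x = 0} := by
    ext x
    simp only [mem_iInter, mem_ofPred_eq]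
    refine ⟨fun hx => le_antisymm ?_ (hf0 x), fun hx n => by rw [hx]; positivity⟩
    exact ge_of_tendsto' tendsto_one_div_add_atTop_nhds_zero_nat hx
  rw [hset] at hlim
  have hlim' := (ENNReal.tendsto_toReal (measure_ne_top μ _)).comp hlim
  obtain ⟨n, hn⟩ := (hlim'.eventually (gt_mem_nhds h)).exists
  have hn1 : 1 / ((n : ℝ) + 1) ≤ 1 := by
    rw [div_le_one (by positivity)]
    linarith [n.cast_nonneg (α := ℝ)]
  refine ⟨1 / ((n : ℝ) + 1) / 2, by positivity, by linarith, ?_⟩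
  rw [mul_div_cancel₀ _ two_ne_zero]
  exact hn

lemma eventually_busemannAverage_pos [IsProbabilityMeasure μ] (hc : Measurable c)
    (hs : Measurable s) (hcs : ∀ x, c x ^ 2 + s x ^ 2 = 1) {p : ℝ × ℝ}
    (hp : p.1 ^ 2 + p.2 ^ 2 = 1) (hmass : μ.real {x | 1 + p.1 * c x + p.2 * s x = 0} < 1 / 2) :
    ∀ᶠ w in 𝓝 p, w.1 ^ 2 + w.2 ^ 2 < 1 → 0 < busemannAverage μ c s w := by
  have hnonneg : ∀ x, 0 ≤ 1 + p.1 * c x + p.2 * s x := fun x => by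
    nlinarith [hcs x, sq_nonneg (p.1 + c x), sq_nonneg (p.2 + s x)]
  obtain ⟨δ, hδ, hδ1, hm⟩ := exists_measureReal_sublevel_lt (by fun_prop) hnonneg hmass
  set S := {x | 1 + p.1 * c x + p.2 * s x ≤ 2 * δ} with hS
  have hSm : MeasurableSet S := measurableSet_le (by fun_prop) measurable_const
  set m := μ.real S
  have hm0 : 0 ≤ m := measureReal_nonneg
  set L := (Real.log 2 - Real.log δ) / (1 / 2 - m) with hL
  have hq : ∀ᶠ w : ℝ × ℝ in 𝓝 p, 1 - w.1 ^ 2 - w.2 ^ 2 < Real.exp (-L) := by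
    have : Continuous fun v : ℝ × ℝ => 1 - v.1 ^ 2 - v.2 ^ 2 := by fun_prop
    exact this.continuousAt.eventually (gt_mem_nhds (by linarith [Real.exp_pos (-L)]))
  have hd : ∀ᶠ w : ℝ × ℝ in 𝓝 p, |w.1 - p.1| + |w.2 - p.2| < δ := by
    have : Continuous fun v : ℝ × ℝ => |v.1 - p.1| + |v.2 - p.2| := by fun_prop
    exact this.continuousAt.eventually (gt_mem_nhds (by simpa using hδ))
  filter_upwards [hq, hd] with w hqw hdw hD
  set q := 1 - w.1 ^ 2 - w.2 ^ 2 with hq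
  have hq0 : 0 < q := by linarith
  have hq1 : q ≤ 1 := by nlinarith [sq_nonneg w.1, sq_nonneg w.2]
  have hlogδ : Real.log δ ≤ 0 := Real.log_nonpos hδ.le hδ1
  have hpt : ∀ x, S.indicator (fun _ => Real.log (q / 2)) x + Real.log δ
      ≤ Real.log (1 + w.1 * c x + w.2 * s x) := by
    intro x
    by_cases hx : x ∈ S
    · rw [indicator_of_mem hx]
      have := Real.log_le_log (by positivity) (half_le_one_add_inner (hcs x))
      linarith
    · rw [indicator_of_notMem hx, zero_add]
      apply Real.log_le_log hδ
      have hx' : 2 * δ < 1 + p.1 * c x + p.2 * s x := not_le.mp hx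
      have hc1 : |c x| ≤ 1 := abs_le_one_iff_mul_self_le_one.mpr (by nlinarith [hcs x])
      have hs1 : |s x| ≤ 1 := abs_le_one_iff_mul_self_le_one.mpr (by nlinarith [hcs x])
      have e1 := neg_abs_le ((w.1 - p.1) * c x)
      have e2 := neg_abs_le ((w.2 - p.2) * s x)
      rw [abs_mul] at e1 e2
      have e3 := mul_le_of_le_one_right (abs_nonneg (w.1 - p.1)) hc1
      have e4 := mul_le_of_le_one_right (abs_nonneg (w.2 - p.2)) hs1
      linarith
  have hint : m * Real.log (q / 2) + Real.log δ
      ≤ ∫ x, Real.log (1 + w.1 * c x + w.2 * s x) ∂μ := by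
    have hi : Integrable (S.indicator fun _ => Real.log (q / 2)) μ :=
      (integrable_const _).indicator hSm
    have := integral_mono (hi.add (integrable_const (Real.log δ)))
      (integrable_log_one_add_inner hc hs hcs hD) hpt
    simpa [integral_add hi (integrable_const _), integral_indicator_const _ hSm] using this
  have hlogq : Real.log q < -L := (Real.log_lt_iff_lt_exp hq0).mpr hqw
  have hLm : L * (1 / 2 - m) = Real.log 2 - Real.log δ :=
    div_mul_cancel₀ _ (by linarith)
  rw [Real.log_div hq0.ne' two_ne_zero] at hint
  have hlog2 : 0 < Real.log 2 := Real.log_pos (by norm_num)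
  unfold busemannAverage
  nlinarith [mul_lt_mul_of_pos_right hlogq (sub_pos.mpr hm)]

lemma exists_forall_busemannAverage_le [IsProbabilityMeasure μ] (hc : Measurable c)
    (hs : Measurable s) (hcs : ∀ x, c x ^ 2 + s x ^ 2 = 1)
    (hmass : ∀ p : ℝ × ℝ, p.1 ^ 2 + p.2 ^ 2 = 1 →
      μ.real {x | 1 + p.1 * c x + p.2 * s x = 0} < 1 / 2) :
    ∃ w : ℝ × ℝ, w.1 ^ 2 + w.2 ^ 2 < 1 ∧ ∀ v : ℝ × ℝ, v.1 ^ 2 + v.2 ^ 2 < 1 →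
      busemannAverage μ c s w ≤ busemannAverage μ c s v := by
  set K := {w : ℝ × ℝ | w.1 ^ 2 + w.2 ^ 2 < 1 ∧ busemannAverage μ c s w ≤ 0} with hK
  have h0 : (0 : ℝ × ℝ) ∈ K := by simp [hK, busemannAverage]
  have hclosed : IsClosed K := by
    rw [← isOpen_compl_iff, isOpen_iff_mem_nhds]
    intro p hp
    have hnorm : Continuous fun v : ℝ × ℝ => v.1 ^ 2 + v.2 ^ 2 := by fun_prop
    rcases lt_trichotomy (p.1 ^ 2 + p.2 ^ 2) 1 with h | h | h
    · have hpos : 0 < busemannAverage μ c s p := by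
        by_contra hneg
        exact hp ⟨h, not_lt.mp hneg⟩
      filter_upwards [(continuousAt_busemannAverage hc hs hcs h).eventually (lt_mem_nhds hpos)]
        with w hw hwK using absurd hwK.2 (not_le.mpr hw)
    · filter_upwards [eventually_busemannAverage_pos hc hs hcs h (hmass p h)]
        with w hw hwK using absurd hwK.2 (not_le.mpr (hw hwK.1))
    · filter_upwards [hnorm.continuousAt.eventually (lt_mem_nhds h)]
        with w hw hwK using lt_asymm hw hwK.1
  have hcompact : IsCompact K := by
    refine (isCompact_Icc (a := ((-1, -1) : ℝ × ℝ)) (b := (1, 1))).of_isClosed_subset hclosed ?_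
    rintro ⟨a, b⟩ ⟨h, -⟩
    simp only at h
    refine ⟨⟨?_, ?_⟩, ?_, ?_⟩ <;> simp only <;> nlinarith [sq_nonneg a, sq_nonneg b]
  obtain ⟨w, hw, hmin⟩ := hcompact.exists_isMinOn ⟨0, h0⟩
    (fun v hv => (continuousAt_busemannAverage (μ := μ) hc hs hcs hv.1).continuousWithinAt)
  refine ⟨w, hw.1, fun v hv => ?_⟩
  by_cases hvK : v ∈ K
  · exact hmin hvK
  · have : 0 < busemannAverage μ c s v := by
      by_contra hneg
      exact hvK ⟨hv, not_lt.mp hneg⟩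
    exact hw.2.trans this.le

/-- Vanishing of the derivative of `busemannAverage` at a minimum, in the direction `(d, e)`. -/
lemma integral_div_one_add_inner_of_forall_le [IsProbabilityMeasure μ] (hc : Measurable c)
    (hs : Measurable s) (hcs : ∀ x, c x ^ 2 + s x ^ 2 = 1) {a b : ℝ} (hD : a ^ 2 + b ^ 2 < 1)
    (hmin : ∀ v : ℝ × ℝ, v.1 ^ 2 + v.2 ^ 2 < 1 →
      busemannAverage μ c s (a, b) ≤ busemannAverage μ c s v) {d e : ℝ}
    (hd : d ^ 2 + e ^ 2 ≤ 1) :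
    ∫ x, (d * c x + e * s x) / (1 + a * c x + b * s x) ∂μ
      = -(d * a + e * b) / (1 - a ^ 2 - b ^ 2) := by
  set I := ∫ x, (d * c x + e * s x) / (1 + a * c x + b * s x) ∂μ with hI
  have hIi : Integrable (fun x => (d * c x + e * s x) / (1 + a * c x + b * s x)) μ := by
    refine integrable_div_one_add_inner hc hs hcs hD (by fun_prop) fun x => ?_
    refine abs_le_one_iff_mul_self_le_one.mpr ?_
    have h : (d * c x + e * s x) ^ 2 + (d * s x - e * c x) ^ 2
        = (d ^ 2 + e ^ 2) * (c x ^ 2 + s x ^ 2) := by ring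
    rw [hcs x] at h
    nlinarith [sq_nonneg (d * s x - e * c x)]
  have hq0 : 0 < 1 - a ^ 2 - b ^ 2 := by linarith
  let g : ℝ → ℝ := fun t => t * I - 1 / 2 * Real.log (1 - (a + t * d) ^ 2 - (b + t * e) ^ 2)
  have hg : HasDerivAt g (I + (d * a + e * b) / (1 - a ^ 2 - b ^ 2)) 0 := by
    have h1 : HasDerivAt (fun t : ℝ => 1 - (a + t * d) ^ 2 - (b + t * e) ^ 2)
        (-(2 * a * d) - 2 * b * e) 0 := by
      have ha := (((hasDerivAt_id (0 : ℝ)).mul_const d).const_add a).pow 2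
      have hb := (((hasDerivAt_id (0 : ℝ)).mul_const e).const_add b).pow 2
      refine ((ha.const_sub 1).sub hb).congr_deriv ?_
      simp
    have h2 := ((hasDerivAt_id (0 : ℝ)).mul_const I).sub
      ((h1.log (by simpa using hq0.ne')).const_mul (1 / 2))
    refine h2.congr_deriv ?_
    simp only [zero_mul, add_zero]
    field_simp
    ring
  have hloc : IsLocalMin g 0 := by
    have hcont : Continuous fun t : ℝ => (a + t * d) ^ 2 + (b + t * e) ^ 2 := by fun_prop
    filter_upwards [hcont.continuousAt.eventually
      (gt_mem_nhds (show (a + 0 * d) ^ 2 + (b + 0 * e) ^ 2 < 1 by simpa using hD))] with t ht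
    have hle := hmin (a + t * d, b + t * e) ht
    have hlog : ∫ x, Real.log (1 + (a + t * d) * c x + (b + t * e) * s x) ∂μ
        ≤ (∫ x, Real.log (1 + a * c x + b * s x) ∂μ) + t * I := by
      rw [hI, ← integral_const_mul,
        ← integral_add (integrable_log_one_add_inner hc hs hcs hD) (hIi.const_mul t)]
      refine integral_mono (integrable_log_one_add_inner hc hs hcs ht)
        ((integrable_log_one_add_inner hc hs hcs hD).add (hIi.const_mul t)) fun x => ?_
      have hx := one_add_inner_pos (hcs x) hD
      have hy := one_add_inner_pos (hcs x) ht
      have h := Real.log_le_sub_one_of_pos (div_pos hy hx)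
      rw [Real.log_div hy.ne' hx.ne'] at h
      have heq : (1 + (a + t * d) * c x + (b + t * e) * s x) / (1 + a * c x + b * s x) - 1
          = t * ((d * c x + e * s x) / (1 + a * c x + b * s x)) := by
        field_simp
        ring
      simp only
      linarith
    simp only [busemannAverage] at hle
    simp only [g, zero_mul, add_zero]
    linarith
  have := hloc.hasDerivAt_eq_zero hg
  rw [neg_div]
  linarith

theorem exists_hyperbolic_barycenter [IsProbabilityMeasure μ] {θ : α → ℝ} (hθ : Measurable θ)
    (hmass : ∀ Θ : ℝ, μ.real {x | Real.cos (θ x - Θ) = 1} < 1 / 2) :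
    ∃ γ ∈ Ico (0:ℝ) 1, ∃ Θ : ℝ,
      (∫ x, Real.sin (θ x - Θ) / (1 + γ * Real.cos (θ x - Θ)) ∂μ) = 0 ∧
      (∫ x, (γ + Real.cos (θ x - Θ)) / (1 + γ * Real.cos (θ x - Θ)) ∂μ) = 0 := by
  have hc : Measurable fun x => Real.cos (θ x) := Real.measurable_cos.comp hθ
  have hs : Measurable fun x => Real.sin (θ x) := Real.measurable_sin.comp hθ
  have hcs : ∀ x, Real.cos (θ x) ^ 2 + Real.sin (θ x) ^ 2 = 1 := fun x => Real.cos_sq_add_sin_sq _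
  have hpolar : ∀ a b : ℝ, ∃ Θ, a = √(a ^ 2 + b ^ 2) * Real.cos Θ ∧
      b = √(a ^ 2 + b ^ 2) * Real.sin Θ := fun a b => by
    have h : ‖(⟨a, b⟩ : ℂ)‖ = √(a ^ 2 + b ^ 2) := by
      rw [Complex.norm_def, Complex.normSq_mk, sq, sq]
    refine ⟨Complex.arg ⟨a, b⟩, ?_, ?_⟩
    · rw [← h, Complex.norm_mul_cos_arg]
    · rw [← h, Complex.norm_mul_sin_arg]
  obtain ⟨⟨a, b⟩, hD, hmin⟩ := exists_forall_busemannAverage_le (μ := μ) hc hs hcs (by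
    rintro ⟨a, b⟩ hp
    simp only at hp ⊢
    obtain ⟨Θ, ha, hb⟩ := hpolar a b
    rw [hp, Real.sqrt_one, one_mul] at ha hb
    convert hmass (Θ + Real.pi) using 4 with x
    rw [← sub_sub, Real.cos_sub_pi, Real.cos_sub, ha, hb]
    constructor <;> intro h <;> linarith)
  simp only at hD
  obtain ⟨Θ, ha, hb⟩ := hpolar a b
  set γ := √(a ^ 2 + b ^ 2)
  have hγ0 : 0 ≤ γ := Real.sqrt_nonneg _
  have hsq : γ ^ 2 = a ^ 2 + b ^ 2 := Real.sq_sqrt (by positivity)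
  have hγ1 : γ < 1 := by nlinarith
  have hden : ∀ x, 1 + γ * Real.cos (θ x - Θ) = 1 + a * Real.cos (θ x) + b * Real.sin (θ x) :=
    fun x => by
      rw [Real.cos_sub]
      linear_combination -Real.cos (θ x) * ha - Real.sin (θ x) * hb
  have hq : 1 - a ^ 2 - b ^ 2 = 1 - γ ^ 2 := by linarith
  have hq0 : 1 - γ ^ 2 ≠ 0 := by nlinarith
  refine ⟨γ, ⟨hγ0, hγ1⟩, Θ, ?_, ?_⟩
  · have h := integral_div_one_add_inner_of_forall_le hc hs hcs hD hmin
      (d := -Real.sin Θ) (e := Real.cos Θ) (by rw [neg_sq, Real.sin_sq_add_cos_sq])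
    have hz : -(-Real.sin Θ * a + Real.cos Θ * b) / (1 - a ^ 2 - b ^ 2) = 0 := by
      rw [div_eq_zero_iff]
      left
      linear_combination Real.sin Θ * ha - Real.cos Θ * hb
    rw [← h.trans hz]
    congr with x
    rw [hden, Real.sin_sub]
    ring
  · have h := integral_div_one_add_inner_of_forall_le hc hs hcs hD hmin
      (d := Real.cos Θ) (e := Real.sin Θ) (Real.cos_sq_add_sin_sq Θ).le
    have hz : -(Real.cos Θ * a + Real.sin Θ * b) / (1 - a ^ 2 - b ^ 2) = -γ / (1 - γ ^ 2) := by
      rw [hq]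
      congr 2
      linear_combination Real.cos Θ * ha + Real.sin Θ * hb + γ * Real.cos_sq_add_sin_sq Θ
    have hi : Integrable (fun x => Real.cos (θ x - Θ) / (1 + γ * Real.cos (θ x - Θ))) μ := by
      simp only [hden]
      exact integrable_div_one_add_inner hc hs hcs hD
        (Real.measurable_cos.comp (hθ.sub_const Θ)) fun x => Real.abs_cos_le_one _
    have hA : ∫ x, Real.cos (θ x - Θ) / (1 + γ * Real.cos (θ x - Θ)) ∂μ = -γ / (1 - γ ^ 2) := by
      rw [← h.trans hz]
      congr with x
      rw [hden, Real.cos_sub]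
      ring
    have hsplit : ∀ x, (γ + Real.cos (θ x - Θ)) / (1 + γ * Real.cos (θ x - Θ))
        = γ + (1 - γ ^ 2) * (Real.cos (θ x - Θ) / (1 + γ * Real.cos (θ x - Θ))) := fun x => by
      have : 1 + γ * Real.cos (θ x - Θ) ≠ 0 := by
        rw [hden]
        exact (one_add_inner_pos (hcs x) hD).ne'
      field_simp
      ring
    simp only [hsplit]
    rw [integral_add (integrable_const _) (hi.const_mul _), integral_const_mul, hA,
      mul_div_cancel₀ _ hq0]
    simp

end HyperbolicBarycenter

/-- Existence of the reduced variables for the Sakaguchi–Kuramoto (Watanabe–Strogatz)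
transformation: if `θ₀` is continuous on `[0,1]` and for every `Θ ∈ [0,2π)` the set of
points whose phase equals `Θ` modulo `2π` has Lebesgue measure `< 1/2`, then there
exist `γ ∈ [0,1)` and `Θ ∈ ℝ` with
`∫₀¹ sin(θ₀(x) − Θ)/(1 + γ cos(θ₀(x) − Θ)) dx = 0` and
`∫₀¹ (γ + cos(θ₀(x) − Θ))/(1 + γ cos(θ₀(x) − Θ)) dx = 0`. -/
theorem statement18 (θ₀ : ℝ → ℝ) (hcont : ContinuousOn θ₀ (Icc 0 1))
    (hhet : ∀ Θ ∈ Ico (0:ℝ) (2 * Real.pi),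
      volume {x ∈ Icc (0:ℝ) 1 | ∃ k : ℤ, θ₀ x = Θ + 2 * Real.pi * k} <
        ENNReal.ofReal (1 / 2)) :
    ∃ γ ∈ Ico (0:ℝ) 1, ∃ Θ : ℝ,
      (∫ x in (0:ℝ)..1, Real.sin (θ₀ x - Θ) / (1 + γ * Real.cos (θ₀ x - Θ))) = 0 ∧
      (∫ x in (0:ℝ)..1, (γ + Real.cos (θ₀ x - Θ)) / (1 + γ * Real.cos (θ₀ x - Θ))) = 0 := by
  have hθ : Continuous (IccExtend zero_le_one ((Icc (0:ℝ) 1).domRestrict θ₀)) :=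
    hcont.domRestrict.Icc_extend'
  have heq : ∀ x ∈ Icc (0:ℝ) 1, IccExtend zero_le_one ((Icc (0:ℝ) 1).domRestrict θ₀) x = θ₀ x :=
    fun x hx => IccExtend_of_mem zero_le_one _ hx
  generalize IccExtend zero_le_one ((Icc (0:ℝ) 1).domRestrict θ₀) = θ at hθ heq
  have : IsProbabilityMeasure (volume.restrict (Ioc (0:ℝ) 1)) := ⟨by simp⟩
  obtain ⟨γ, hγ, Θ, h1, h2⟩ :=
    exists_hyperbolic_barycenter (μ := volume.restrict (Ioc (0:ℝ) 1)) hθ.measurable (by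
      intro Θ
      have hlt := hhet (toIcoMod Real.two_pi_pos 0 Θ) (by
        simpa using toIcoMod_mem_Ico Real.two_pi_pos 0 Θ)
      rw [measureReal_def, Measure.restrict_apply
        (measurableSet_eq_fun (by fun_prop) measurable_const)]
      refine ENNReal.toReal_lt_of_lt_ofReal (lt_of_le_of_lt (measure_mono ?_) hlt)
      rintro x ⟨hx, hxI⟩
      have hxI' := Ioc_subset_Icc_self hxI
      obtain ⟨n, hn⟩ := (Real.cos_eq_one_iff _).mp hx
      refine ⟨hxI', n + toIcoDiv Real.two_pi_pos 0 Θ, ?_⟩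
      rw [← heq x hxI']
      have hΘ := toIcoMod_add_toIcoDiv_zsmul Real.two_pi_pos 0 Θ
      rw [zsmul_eq_mul] at hΘ
      push_cast
      linarith)
  refine ⟨γ, hγ, Θ, ?_, ?_⟩
  · rw [intervalIntegral.integral_of_le zero_le_one]
    refine (setIntegral_congr_fun measurableSet_Ioc fun x hx => ?_).trans h1
    simp only [heq x (Ioc_subset_Icc_self hx)]
  · rw [intervalIntegral.integral_of_le zero_le_one]
    refine (setIntegral_congr_fun measurableSet_Ioc fun x hx => ?_).trans h2
    simp only [heq x (Ioc_subset_Icc_self hx)]
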